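/- arXiv:2106.03107 — 2 statements merged into one kernel-verified Lean document; each statement's English description precedes it below -/
import Mathlib

section
/- If there exists a real m_∞ > 0 with c_j ≥ m_∞ for every c ∈ U and every coordinate j, and every x ∈ X is nonzero, then opt(n) = opt(n+1); consequently opt(k) = opt(n) for every integer k ≥ n. -/
open scoped BigOperators

/-- Dot product of two vectors in `ℝ^ν`. -/
noncomputable def dot {ν : ℕ} (c x : Fin ν → ℝ) : ℝ := ∑ j, c j * x j

/-- `convComb X k` is the set `X(k)` of all convex combinations of at most `k` points of `X`. -/
def convComb {ν : ℕ} (X : Set (Fin ν → ℝ)) (k : ℕ) : Set (Fin ν → ℝ) :=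
  { x | ∃ (xs : Fin k → (Fin ν → ℝ)) (lam : Fin k → ℝ),
      (∀ i, xs i ∈ X) ∧ (∀ i, 0 ≤ lam i) ∧ (∑ i, lam i) = 1 ∧
      x = ∑ i, lam i • xs i }

/-- The worst-case objective `max_{c ∈ U} cᵀx`. -/
noncomputable def objSup {ν : ℕ} (U : Set (Fin ν → ℝ)) (x : Fin ν → ℝ) : ℝ :=
  sSup ((fun c => dot c x) '' U)

/-- `opt(k) = min_{x ∈ X(k)} max_{c ∈ U} cᵀx`. -/
noncomputable def optVal {ν : ℕ} (X U : Set (Fin ν → ℝ)) (k : ℕ) : ℝ :=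
  sInf (objSup U '' convComb X k)

/-- `‖x‖₀`, the number of nonzero entries of `x`, as a real number. -/
noncomputable def zeroNorm {ν : ℕ} (x : Fin ν → ℝ) : ℝ :=
  ((Finset.univ.filter (fun j => x j ≠ 0)).card : ℝ)

/-- The min-max-min robust value over `k`-tuples of feasible solutions:
`min_{x¹,…,x^k ∈ X} max_{c ∈ U} min_{i} cᵀxⁱ`. -/
noncomputable def minmaxVal {ν : ℕ} (X U : Set (Fin ν → ℝ)) (k : ℕ) : ℝ :=
  sInf { v : ℝ | ∃ xs : Fin k → (Fin ν → ℝ), (∀ i, xs i ∈ X) ∧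
    v = sSup ((fun c => ⨅ i, dot c (xs i)) '' U) }

/-- `app(k)`, the objective value of the `k` solutions `x¹,…,x^k` with largest weights
returned by Algorithm 1: `max_{c ∈ U} min_{i=1,…,k} cᵀxⁱ`. -/
noncomputable def appVal {ν : ℕ} (U : Set (Fin ν → ℝ)) (xs : Fin ν → (Fin ν → ℝ)) (k : ℕ) : ℝ :=
  sSup ((fun c => ⨅ i : {i : Fin ν // (i : ℕ) < k}, dot c (xs i.1)) '' U)

theorem convComb_subset_succ {ν k : ℕ} {X : Set (Fin ν → ℝ)} (hX : X.Nonempty) :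
    convComb X k ⊆ convComb X (k + 1) := by
  rintro _ ⟨xs, w, hxs, hw, hw1, rfl⟩
  obtain ⟨p, hp⟩ := hX
  refine ⟨Fin.cons p xs, Fin.cons 0 w, ?_, ?_, ?_, ?_⟩
  · intro i
    cases i using Fin.cases <;> simp [hp, hxs]
  · intro i
    cases i using Fin.cases <;> simp [hw]
  · simp [Fin.sum_univ_succ, hw1]
  · simp [Fin.sum_univ_succ]

theorem convComb_nonempty {ν k : ℕ} {X : Set (Fin ν → ℝ)} (hX : X.Nonempty) (hk : 0 < k) :
    (convComb X k).Nonempty := by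
  obtain ⟨p, hp⟩ := hX
  refine ⟨p, fun _ => p, Pi.single ⟨0, hk⟩ 1, fun _ => hp, fun i => ?_, ?_, ?_⟩
  · rw [Pi.single_apply]
    split_ifs <;> norm_num
  · simp
  · rw [← Finset.sum_smul]
    simp

theorem nonneg_of_mem_convComb {ν k : ℕ} {X : Set (Fin ν → ℝ)} (hX : ∀ x ∈ X, 0 ≤ x)
    {x : Fin ν → ℝ} (hx : x ∈ convComb X k) : 0 ≤ x := by
  obtain ⟨xs, w, hxs, hw, -, rfl⟩ := hx
  exact Finset.sum_nonneg fun i _ => smul_nonneg (hw i) (hX _ (hxs i))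

/-- A nontrivial linear relation among nonnegative nonzero vectors, with nonnegative total
coefficient, has a negative coefficient. -/
theorem exists_neg_of_sum_smul_eq_zero {ν : ℕ} {ι : Type*} [Fintype ι] {xs : ι → Fin ν → ℝ}
    (hxs : ∀ i, 0 < xs i) {a : ι → ℝ} (ha : a ≠ 0) (h : ∑ i, a i • xs i = 0) :
    ∃ i, a i < 0 := by
  by_contra! hnn
  refine ha (funext fun i => ?_)
  have h0 := (Finset.sum_eq_zero_iff_of_nonneg
    (fun i _ => smul_nonneg (hnn i) (hxs i).le)).1 h i (Finset.mem_univ i)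
  exact (smul_eq_zero.1 h0).resolve_right (hxs i).ne'

/-- Nonnegative weights can be changed along a linear relation so that one of them vanishes,
the combination is unchanged, and the total weight does not decrease. -/
theorem exists_weights_eq_zero {ν : ℕ} {ι : Type*} [Fintype ι] {xs : ι → Fin ν → ℝ}
    (hxs : ∀ i, 0 < xs i) (hι : ν < Fintype.card ι) {w : ι → ℝ} (hw : ∀ i, 0 ≤ w i) :
    ∃ w' : ι → ℝ, (∀ i, 0 ≤ w' i) ∧ (∃ i, w' i = 0) ∧ ∑ i, w i ≤ ∑ i, w' i ∧
      ∑ i, w' i • xs i = ∑ i, w i • xs i := by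
  obtain ⟨a, ha, hrel, hsum⟩ : ∃ a : ι → ℝ, a ≠ 0 ∧ ∑ i, a i • xs i = 0 ∧ 0 ≤ ∑ i, a i := by
    have hdep : ¬ LinearIndependent ℝ xs := fun hli => by
      have := hli.fintype_card_le_finrank
      simp at this
      omega
    obtain ⟨g, hg, i, hi⟩ := Fintype.not_linearIndependent_iff.1 hdep
    have hg0 : g ≠ 0 := fun h => hi (congrFun h i)
    rcases le_total 0 (∑ i, g i) with h | h
    · exact ⟨g, hg0, hg, h⟩
    · exact ⟨-g, neg_ne_zero.2 hg0, by simp [hg], by simpa using h⟩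
  obtain ⟨i₁, hi₁⟩ := exists_neg_of_sum_smul_eq_zero hxs ha hrel
  obtain ⟨i₀, hi₀, hmin⟩ := Finset.exists_min_image (Finset.univ.filter fun i => a i < 0)
    (fun i => w i / -a i) ⟨i₁, by simpa using hi₁⟩
  simp only [Finset.mem_filter, Finset.mem_univ, true_and] at hi₀ hmin
  have hs : 0 ≤ w i₀ / -a i₀ := div_nonneg (hw _) (by linarith)
  refine ⟨fun i => w i + w i₀ / -a i₀ * a i, fun i => ?_, ⟨i₀, ?_⟩, ?_, ?_⟩
  · rcases lt_or_ge (a i) 0 with hi | hi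
    · have := (le_div_iff₀ (neg_pos.2 hi)).1 (hmin i hi)
      linarith
    · exact add_nonneg (hw i) (mul_nonneg hs hi)
  · have := hi₀.ne
    field_simp
    ring
  · rw [Finset.sum_add_distrib, ← Finset.mul_sum]
    exact le_add_of_nonneg_right (mul_nonneg hs hsum)
  · simp only [add_smul, mul_smul, Finset.sum_add_distrib, ← Finset.smul_sum, hrel, smul_zero,
      add_zero]

/-- Shrinking towards the origin a convex combination of `k + 1 > ν` nonnegative nonzero vectors
gives a convex combination of `k` of them. -/
theorem exists_smul_mem_convComb {ν k : ℕ} (hk : ν ≤ k) {X : Set (Fin ν → ℝ)}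
    (hX : ∀ x ∈ X, 0 < x) {x : Fin ν → ℝ} (hx : x ∈ convComb X (k + 1)) :
    ∃ t : ℝ, 0 ≤ t ∧ t ≤ 1 ∧ t • x ∈ convComb X k := by
  obtain ⟨xs, w, hxs, hw, hw1, rfl⟩ := hx
  obtain ⟨w', hw', ⟨i₀, hi₀⟩, hle, heq⟩ := exists_weights_eq_zero (fun i => hX _ (hxs i))
    (by simpa using Nat.lt_succ_of_le hk) hw
  rw [hw1] at hle
  have hpos : 0 < ∑ i, w' i := one_pos.trans_le hle
  refine ⟨(∑ i, w' i)⁻¹, inv_nonneg.2 hpos.le, inv_le_one_of_one_le₀ hle,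
    fun i => xs (i₀.succAbove i), fun i => (∑ i, w' i)⁻¹ * w' (i₀.succAbove i),
    fun i => hxs _, fun i => mul_nonneg (inv_nonneg.2 hpos.le) (hw' _), ?_, ?_⟩
  · have h := Fin.sum_univ_succAbove w' i₀
    rw [hi₀, zero_add] at h
    rw [← Finset.mul_sum, ← h, inv_mul_cancel₀ hpos.ne']
  · rw [← heq, Fin.sum_univ_succAbove (fun i => w' i • xs i) i₀, hi₀, zero_smul, zero_add,
      Finset.smul_sum]
    simp only [mul_smul]

theorem objSup_nonneg {ν : ℕ} {U : Set (Fin ν → ℝ)} (hU : ∀ c ∈ U, 0 ≤ c) {x : Fin ν → ℝ}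
    (hx : 0 ≤ x) : 0 ≤ objSup U x := by
  refine Real.sSup_nonneg ?_
  rintro _ ⟨c, hc, rfl⟩
  exact Finset.sum_nonneg fun j _ => mul_nonneg (hU c hc j) (hx j)

theorem objSup_smul {ν : ℕ} (U : Set (Fin ν → ℝ)) {t : ℝ} (ht : 0 ≤ t) (x : Fin ν → ℝ) :
    objSup U (t • x) = t * objSup U x := by
  rw [objSup, objSup, ← smul_eq_mul, ← Real.sSup_smul_of_nonneg ht, ← Set.image_smul,
    Set.image_image]
  congr! 2 with c
  simp [dot, Finset.mul_sum, mul_left_comm]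

theorem optVal_succ {ν k : ℕ} (hk : ν ≤ k) (hk0 : 0 < k) {X U : Set (Fin ν → ℝ)}
    (hXne : X.Nonempty) (hX : ∀ x ∈ X, 0 < x) (hU : ∀ c ∈ U, 0 ≤ c) :
    optVal X U (k + 1) = optVal X U k := by
  have hnn : ∀ {l : ℕ} {x}, x ∈ convComb X l → 0 ≤ objSup U x := fun hx =>
    objSup_nonneg hU (nonneg_of_mem_convComb (fun x hx => (hX x hx).le) hx)
  have hbdd : ∀ l, BddBelow (objSup U '' convComb X l) := fun l =>
    ⟨0, by rintro _ ⟨x, hx, rfl⟩; exact hnn hx⟩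
  apply le_antisymm
  · exact csInf_le_csInf (hbdd _) ((convComb_nonempty hXne hk0).image _)
      (Set.image_mono (convComb_subset_succ hXne))
  · refine le_csInf ((convComb_nonempty hXne k.succ_pos).image _) ?_
    rintro _ ⟨x, hx, rfl⟩
    obtain ⟨t, ht0, ht1, ht⟩ := exists_smul_mem_convComb hk hX hx
    refine (csInf_le (hbdd _) ⟨_, ht, rfl⟩).trans ?_
    rw [objSup_smul U ht0]
    exact mul_le_of_le_one_left (hnn hx) ht1

/-- If `c_j ≥ m_∞ > 0` for all `c ∈ U` and all coordinates `j`, and every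
`x ∈ X` is nonzero, then `opt(n) = opt(n+1)`, hence `opt(k) = opt(n)` for all `k ≥ n`. -/
theorem stmt2 (n : ℕ) (hn : 0 < n)
    (X : Set (Fin n → ℝ)) (hXfin : X.Finite) (hXne : X.Nonempty)
    (hXbin : ∀ x ∈ X, ∀ j, x j = 0 ∨ x j = 1)
    (U : Set (Fin n → ℝ)) (hUne : U.Nonempty) (hUcomp : IsCompact U) (hUconv : Convex ℝ U)
    (m_inf : ℝ) (hminf : 0 < m_inf) (hc : ∀ c ∈ U, ∀ j, m_inf ≤ c j)
    (hx0 : ∀ x ∈ X, x ≠ 0) :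
    optVal X U n = optVal X U (n + 1) ∧
    (∀ k : ℕ, n ≤ k → optVal X U k = optVal X U n) := by
  have hX : ∀ x ∈ X, 0 < x := fun x hx =>
    lt_of_le_of_ne (fun j => by rcases hXbin x hx j with h | h <;> simp [h]) (hx0 x hx).symm
  have hU : ∀ c ∈ U, 0 ≤ c := fun c hcU j => hminf.le.trans (hc c hcU j)
  refine ⟨(optVal_succ le_rfl hn hXne hX hU).symm, fun k hk => ?_⟩
  induction k, hk using Nat.le_induction with
  | base => rfl
  | succ k hk ih => exact (optVal_succ hk (hn.trans_le hk) hXne hX hU).trans ih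
end

section
/- For every integer k ≥ 1, the min-max-min robust value over k-tuples of solutions equals the convexified value: min over (x^1,…,x^k) ∈ X^k of max_{c ∈ U} min_{i=1,…,k} cᵀx^i equals opt(k) = min_{x ∈ X(k)} max_{c ∈ U} cᵀx. -/
open scoped BigOperators

lemma continuous_dot_left {ν : ℕ} (x : Fin ν → ℝ) : Continuous fun c => dot c x := by
  unfold dot
  fun_prop

lemma dot_sum_smul {ν : ℕ} {ι : Type*} [Fintype ι] (c : Fin ν → ℝ) (lam : ι → ℝ)
    (xs : ι → Fin ν → ℝ) : dot c (∑ i, lam i • xs i) = ∑ i, lam i * dot c (xs i) := by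
  change c ⬝ᵥ (∑ i, lam i • xs i) = ∑ i, lam i * (c ⬝ᵥ xs i)
  simp only [dotProduct_sum, dotProduct_smul, smul_eq_mul]

lemma bddAbove_dot_image {ν : ℕ} {U : Set (Fin ν → ℝ)} (hU : IsCompact U) (x : Fin ν → ℝ) :
    BddAbove ((fun c => dot c x) '' U) :=
  (hU.image (continuous_dot_left x)).bddAbove

lemma bddAbove_iInf_dot_image {ν : ℕ} {ι : Type*} [Finite ι] [Nonempty ι]
    {U : Set (Fin ν → ℝ)} (hU : IsCompact U) (xs : ι → Fin ν → ℝ) :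
    BddAbove ((fun c => ⨅ i, dot c (xs i)) '' U) := by
  obtain ⟨i⟩ := ‹Nonempty ι›
  obtain ⟨M, hM⟩ := bddAbove_dot_image hU (xs i)
  refine ⟨M, ?_⟩
  rintro _ ⟨c, hc, rfl⟩
  exact (ciInf_le (Set.finite_range _).bddBelow i).trans (hM ⟨c, hc, rfl⟩)

/-- The minimum of finitely many reals is at most any convex combination of them. -/
lemma iInf_le_sum_mul {ι : Type*} [Fintype ι] {lam : ι → ℝ} (h0 : ∀ i, 0 ≤ lam i)
    (h1 : ∑ i, lam i = 1) (a : ι → ℝ) : ⨅ i, a i ≤ ∑ i, lam i * a i := by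
  calc ⨅ i, a i = ∑ i, lam i * ⨅ j, a j := by rw [← Finset.sum_mul, h1, one_mul]
    _ ≤ ∑ i, lam i * a i := Finset.sum_le_sum fun i _ =>
      mul_le_mul_of_nonneg_left (ciInf_le (Set.finite_range a).bddBelow i) (h0 i)

/-- A theorem of the alternative: a nonempty convex set that misses the open positive orthant
has a convex weight vector under which all its points have nonpositive weighted sum. -/
lemma exists_weights_nonpos {ι : Type*} [Fintype ι] {C : Set (ι → ℝ)} (hC : Convex ℝ C)
    (hne : C.Nonempty) (hpos : ∀ y ∈ C, ∃ i, y i ≤ 0) :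
    ∃ lam : ι → ℝ, (∀ i, 0 ≤ lam i) ∧ ∑ i, lam i = 1 ∧ ∀ y ∈ C, ∑ i, lam i * y i ≤ 0 := by
  classical
  let P : Set (ι → ℝ) := Set.univ.pi fun _ => Set.Ioi 0
  have hPopen : IsOpen P := isOpen_set_pi Set.finite_univ fun _ _ => isOpen_Ioi
  have hPconv : Convex ℝ P := convex_pi fun _ _ => convex_Ioi 0
  have hdisj : Disjoint P C := by
    rw [Set.disjoint_left]
    intro y hy hyC
    obtain ⟨i, hi⟩ := hpos y hyC
    exact absurd (hy i trivial) (not_lt.mpr hi)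
  obtain ⟨f, u, hf, hu⟩ := geometric_hahn_banach_open hPconv hPopen hC hdisj
  have hle : ∀ y : ι → ℝ, (∀ i, 0 ≤ y i) → f y ≤ u := by
    intro y hy
    have hlim : Filter.Tendsto (fun t : ℝ => f (y + t • 1)) (nhdsWithin 0 (Set.Ioi 0))
        (nhds (f y)) := by
      have : Continuous fun t : ℝ => f (y + t • 1) := by fun_prop
      simpa using this.continuousWithinAt (x := 0) (s := Set.Ioi 0) |>.tendsto
    refine le_of_tendsto hlim ?_
    filter_upwards [self_mem_nhdsWithin] with t ht
    refine (hf _ fun i _ => ?_).le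
    have : 0 < t := ht
    simpa using add_pos_of_nonneg_of_pos (hy i) this
  have hu0 : 0 ≤ u := by simpa using hle 0 fun _ => le_rfl
  let w : ι → ℝ := fun i => -f (Pi.single i 1)
  have hfw : ∀ y, ∑ i, w i * y i = -f y := by
    intro y
    conv_rhs => rw [pi_eq_sum_univ' y, map_sum, ← Finset.sum_neg_distrib]
    refine Finset.sum_congr rfl fun i _ => ?_
    simp [w, mul_comm]
  have hw0 : ∀ i, 0 ≤ w i := by
    intro i
    by_contra! hi
    have hfi : 0 < f (Pi.single i 1) := by simpa [w] using hi
    have h := hle (((u + 1) / f (Pi.single i 1)) • Pi.single i 1) fun j => by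
      have : (0 : ℝ) ≤ (Pi.single i 1 : ι → ℝ) j := by
        rw [Pi.single_apply]; split_ifs <;> norm_num
      simp only [Pi.smul_apply, smul_eq_mul]
      positivity
    rw [map_smul, smul_eq_mul, div_mul_cancel₀ _ hfi.ne'] at h
    linarith
  have hsum : 0 < ∑ i, w i := by
    refine (Finset.sum_nonneg fun i _ => hw0 i).lt_of_ne fun h => ?_
    have hw : ∀ i, w i = 0 := fun i =>
      (Finset.sum_eq_zero_iff_of_nonneg fun i _ => hw0 i).mp h.symm i (Finset.mem_univ i)
    have hf0 : ∀ y, f y = 0 := fun y => by simpa [hw] using hfw y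
    obtain ⟨y, hy⟩ := hne
    have h1 := hf 1 fun i _ => by simp
    have h2 := hu y hy
    rw [hf0] at h1 h2
    linarith
  refine ⟨fun i => w i / ∑ j, w j, fun i => div_nonneg (hw0 i) hsum.le, ?_, fun y hy => ?_⟩
  · rw [← Finset.sum_div, div_self hsum.ne']
  · simp only [div_mul_eq_mul_div]
    rw [← Finset.sum_div, hfw]
    exact div_nonpos_of_nonpos_of_nonneg (by linarith [hu y hy]) hsum.le

/-- The worst case of a convex combination dominates the worst case of the best point. -/
lemma sSup_iInf_dot_le_objSup {ν : ℕ} {ι : Type*} [Fintype ι] {U : Set (Fin ν → ℝ)}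
    (hUne : U.Nonempty) (hU : IsCompact U) {lam : ι → ℝ} (h0 : ∀ i, 0 ≤ lam i)
    (h1 : ∑ i, lam i = 1) (xs : ι → Fin ν → ℝ) :
    sSup ((fun c => ⨅ i, dot c (xs i)) '' U) ≤ objSup U (∑ i, lam i • xs i) := by
  refine csSup_le (hUne.image _) ?_
  rintro _ ⟨c, hc, rfl⟩
  refine (iInf_le_sum_mul h0 h1 _).trans ?_
  rw [← dot_sum_smul]
  exact le_csSup (bddAbove_dot_image hU _) ⟨c, hc, rfl⟩

/-- Minimax: some convex combination attains the worst case of the best point. -/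
lemma exists_objSup_le_sSup_iInf_dot {ν : ℕ} {ι : Type*} [Fintype ι] [Nonempty ι]
    {U : Set (Fin ν → ℝ)} (hUne : U.Nonempty) (hU : IsCompact U) (hUconv : Convex ℝ U)
    (xs : ι → Fin ν → ℝ) :
    ∃ lam : ι → ℝ, (∀ i, 0 ≤ lam i) ∧ ∑ i, lam i = 1 ∧
      objSup U (∑ i, lam i • xs i) ≤ sSup ((fun c => ⨅ i, dot c (xs i)) '' U) := by
  set v := sSup ((fun c => ⨅ i, dot c (xs i)) '' U) with hv
  have hconv : Convex ℝ ((fun c i => dot c (xs i) - v) '' U) := by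
    rintro _ ⟨c, hc, rfl⟩ _ ⟨d, hd, rfl⟩ a b ha hb hab
    refine ⟨a • c + b • d, hUconv hc hd ha hb hab, ?_⟩
    ext i
    have : dot (a • c + b • d) (xs i) = a * dot c (xs i) + b * dot d (xs i) := by
      change (a • c + b • d) ⬝ᵥ xs i = a * (c ⬝ᵥ xs i) + b * (d ⬝ᵥ xs i)
      simp [add_dotProduct, smul_dotProduct]
    simp only [this, Pi.add_apply, Pi.smul_apply, smul_eq_mul]
    linear_combination v * hab
  obtain ⟨lam, h0, h1, h⟩ := exists_weights_nonpos hconv (hUne.image _) (by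
    rintro _ ⟨c, hc, rfl⟩
    obtain ⟨i, hi⟩ := exists_eq_ciInf_of_finite (f := fun i => dot c (xs i))
    refine ⟨i, sub_nonpos.mpr ?_⟩
    rw [hi]
    exact le_csSup (bddAbove_iInf_dot_image hU xs) ⟨c, hc, rfl⟩)
  refine ⟨lam, h0, h1, csSup_le (hUne.image _) ?_⟩
  rintro _ ⟨c, hc, rfl⟩
  have hc := h _ ⟨c, hc, rfl⟩
  simp only [mul_sub, Finset.sum_sub_distrib, ← Finset.sum_mul, h1, one_mul] at hc
  simpa only [dot_sum_smul] using sub_nonpos.mp hc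

/-- For every `k ≥ 1`, the min-max-min robust value over `k`-tuples of
solutions equals the convexified value `opt(k)`. -/
theorem stmt3 (n : ℕ) (hn : 0 < n)
    (X : Set (Fin n → ℝ)) (hXfin : X.Finite) (hXne : X.Nonempty)
    (hXbin : ∀ x ∈ X, ∀ j, x j = 0 ∨ x j = 1)
    (U : Set (Fin n → ℝ)) (hUne : U.Nonempty) (hUcomp : IsCompact U) (hUconv : Convex ℝ U) :
    ∀ k : ℕ, 1 ≤ k → minmaxVal X U k = optVal X U k := by
  intro k hk
  have : Nonempty (Fin k) := ⟨⟨0, hk⟩⟩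
  obtain ⟨x₀, hx₀⟩ := hXne
  have hbdd : BddBelow { v : ℝ | ∃ xs : Fin k → (Fin n → ℝ), (∀ i, xs i ∈ X) ∧
      v = sSup ((fun c => ⨅ i, dot c (xs i)) '' U) } := by
    have hfin : {xs : Fin k → (Fin n → ℝ) | ∀ i, xs i ∈ X}.Finite := Set.Finite.pi' fun _ => hXfin
    refine (hfin.image fun xs => sSup ((fun c => ⨅ i, dot c (xs i)) '' U)).bddBelow.mono ?_
    rintro _ ⟨xs, hxs, rfl⟩
    exact ⟨xs, hxs, rfl⟩
  have hlow : ∀ y ∈ objSup U '' convComb X k, minmaxVal X U k ≤ y := by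
    rintro _ ⟨_, ⟨xs, lam, hxs, h0, h1, rfl⟩, rfl⟩
    exact (csInf_le hbdd ⟨xs, hxs, rfl⟩).trans (sSup_iInf_dot_le_objSup hUne hUcomp h0 h1 xs)
  refine le_antisymm (le_csInf ?_ hlow) (le_csInf ⟨_, fun _ => x₀, fun _ => hx₀, rfl⟩ ?_)
  · obtain ⟨lam, h0, h1, -⟩ :=
      exists_objSup_le_sSup_iInf_dot hUne hUcomp hUconv fun _ : Fin k => x₀
    exact ⟨_, _, ⟨fun _ => x₀, lam, fun _ => hx₀, h0, h1, rfl⟩, rfl⟩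
  · rintro _ ⟨xs, hxs, rfl⟩
    obtain ⟨lam, h0, h1, h⟩ := exists_objSup_le_sSup_iInf_dot hUne hUcomp hUconv xs
    exact (csInf_le ⟨_, hlow⟩ ⟨_, ⟨xs, lam, hxs, h0, h1, rfl⟩, rfl⟩).trans h
end
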